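/- arXiv:1412.0609 — 2 statements merged into one kernel-verified Lean document; each statement's English description precedes it below -/
import Mathlib

section
/- Let f and g be continuous, positive, non-increasing functions on [0,∞), let r ∈ ℕ, n ∈ ℤ₊, a > 0, and let δ := ‖G_{r,n,f,a}‖_{C[0,a],f}. Then for every k = 1, 2, …, r−1 and every function x ∈ W^r_{f,g}(ℝ₊) with ‖x‖_{C[0,∞),f} ≤ δ one has ‖x^{(k)}‖_{C[0,∞)} ≤ ‖G_{r,n,f,a}^{(k)}‖_{C[0,a]}; that is, ω(D^k, δ) ≤ ‖G_{r,n,f,a}^{(k)}‖_{C[0,a]}. -/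
open Set Filter MeasureTheory
open scoped Topology

noncomputable section

/-- Weighted sup-norm `‖x‖_{C(S),w} = sup_{t ∈ S} |x t| / w t`. -/
def wNorm (x w : ℝ → ℝ) (S : Set ℝ) : ℝ :=
  sSup ((fun t => |x t| / w t) '' S)

/-- Sup-norm `‖x‖_{C(S)} = sup_{t ∈ S} |x t|`. -/
def supNorm (x : ℝ → ℝ) (S : Set ℝ) : ℝ :=
  sSup ((fun t => |x t|) '' S)

/-- `G` is a perfect `g`-spline of order `r` on `[0,a]` with exactly `m` knots
`u 1 < ⋯ < u m` (where `u 0 = 0` and `u (m+1) = a`) and sign `ε ∈ {1,-1}`: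
`G ∈ C^{r-1}[0,a]`, and on each open interval between consecutive knots `G` is
`r` times differentiable with `G^{(r)}(t) = ε·(-1)^i·g(t)` there. -/
def PerfectSplineWith (g : ℝ → ℝ) (r : ℕ) (a : ℝ) (m : ℕ) (u : ℕ → ℝ) (ε : ℝ)
    (G : ℝ → ℝ) : Prop :=
  (ε = 1 ∨ ε = -1) ∧ u 0 = 0 ∧ u (m + 1) = a ∧ (∀ i ≤ m, u i < u (i + 1)) ∧
  ContDiffOn ℝ (r - 1 : ℕ) G (Icc 0 a) ∧
  ∀ i ≤ m, ContDiffOn ℝ (r : ℕ) G (Ioo (u i) (u (i + 1))) ∧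
    ∀ s ∈ Ioo (u i) (u (i + 1)),
      iteratedDerivWithin r G (Ioo (u i) (u (i + 1))) s = ε * (-1 : ℝ) ^ i * g s

/-- `Γ^r_{n,g}[0,a]`: perfect `g`-splines of order `r` on `[0,a]` with at most `n` knots. -/
def InGamma (g : ℝ → ℝ) (r n : ℕ) (a : ℝ) (G : ℝ → ℝ) : Prop :=
  ∃ m ≤ n, ∃ u : ℕ → ℝ, ∃ ε : ℝ, PerfectSplineWith g r a m u ε G

/-- `b 1 < ⋯ < b (n+r+1)` are `n+r+1` oscillation points of `G` on `[0,a]`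
with respect to the weight `f`, as in (5). -/
def OscPointsAt (f : ℝ → ℝ) (r n : ℕ) (a : ℝ) (G : ℝ → ℝ) (b : ℕ → ℝ) : Prop :=
  0 ≤ b 1 ∧ b (n + r + 1) = a ∧ (∀ i, 1 ≤ i → i < n + r + 1 → b i < b (i + 1)) ∧
  ∀ i, 1 ≤ i → i ≤ n + r + 1 →
    G (b i) = (-1 : ℝ) ^ (i + r + 1) * (wNorm G f (Icc 0 a) * f (b i))

/-- `G` has `n+r+1` oscillation points on `[0,a]`. -/
def HasOsc (f : ℝ → ℝ) (r n : ℕ) (a : ℝ) (G : ℝ → ℝ) : Prop :=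
  ∃ b : ℕ → ℝ, OscPointsAt f r n a G b

/-- `G` is the extremal spline `G_{r,n,f,a}`: a member of `Γ^r_{n,g}[0,a]`
with `n+r+1` oscillation points. -/
def IsExtremalSpline (f g : ℝ → ℝ) (r n : ℕ) (a : ℝ) (G : ℝ → ℝ) : Prop :=
  InGamma g r n a G ∧ HasOsc f r n a G

/-- Iterated antiderivatives: `g_0 = g`, `g_{k+1}(t) = ∫_0^t g_k`. -/
def gk (g : ℝ → ℝ) : ℕ → ℝ → ℝ
  | 0 => g
  | k + 1 => fun t => ∫ s in (0:ℝ)..t, gk g k s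

/-- The constants `A_k` of the paper:
`A_0 = ∫_0^∞ g`, and
`A_k = ∫_0^∞ [ Σ_{s=0}^{k-1} (-1)^{k-s-1} A_s t^{k-s-1}/(k-s-1)! + (-1)^k g_k(t) ] dt`. -/
def Acoef (g : ℝ → ℝ) : ℕ → ℝ
  | 0 => ∫ t in Ioi (0 : ℝ), g t
  | k + 1 => ∫ t in Ioi (0 : ℝ),
      ((∑ s : Fin (k + 1), (-1 : ℝ) ^ (k - s.1) * Acoef g s.1 * t ^ (k - s.1) /
        (Nat.factorial (k - s.1) : ℝ)) + (-1 : ℝ) ^ (k + 1) * gk g (k + 1) t)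

/-- `P_k(t) = Σ_{s=0}^{k-1} (-1)^{k-s-1} A_s t^{k-s-1}/(k-s-1)! + (-1)^k g_k(t)`. -/
def Pfun (g : ℝ → ℝ) (k : ℕ) (t : ℝ) : ℝ :=
  (∑ s : Fin k, (-1 : ℝ) ^ (k - 1 - s.1) * Acoef g s.1 * t ^ (k - 1 - s.1) /
    (Nat.factorial (k - 1 - s.1) : ℝ)) + (-1 : ℝ) ^ k * gk g k t

/-- Conditions (6): `A_0 < ∞` and `A_k < ∞` for `k = 1, …, r-1`,
expressed as integrability of the corresponding integrands over `(0,∞)`. -/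
def Cond6 (g : ℝ → ℝ) (r : ℕ) : Prop :=
  IntegrableOn g (Ioi 0) ∧ ∀ k, 1 ≤ k → k ≤ r - 1 → IntegrableOn (Pfun g k) (Ioi 0)

/-- Membership in the class `W^r_{f,g}(ℝ₊)`: `x ∈ C[0,∞)` with
`‖x‖_{C[0,∞),f} < ∞`, `x ∈ C^{r-1}[0,∞)`, `x^{(r-1)}` locally absolutely
continuous with `|x^{(r)}| ≤ g` a.e., the latter encoded by the increment bound
`|x^{(r-1)}(t) - x^{(r-1)}(s)| ≤ ∫_s^t g`. -/
def MemW (f g : ℝ → ℝ) (r : ℕ) (x : ℝ → ℝ) : Prop :=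
  ContinuousOn x (Ici 0) ∧
  ContDiffOn ℝ (r - 1 : ℕ) x (Ici 0) ∧
  BddAbove ((fun t => |x t| / f t) '' Ici 0) ∧
  ∀ s t : ℝ, 0 ≤ s → s ≤ t →
    |iteratedDerivWithin (r - 1) x (Ici 0) t - iteratedDerivWithin (r - 1) x (Ici 0) s| ≤
      ∫ u in s..t, g u

/-- The modulus of continuity `ω(D^k, δ)` of the `k`-th differentiation operator on
`W^r_{f,g}(ℝ₊)`. -/
def omegaD (f g : ℝ → ℝ) (r k : ℕ) (δ : ℝ) : ℝ :=
  sSup {y | ∃ x : ℝ → ℝ, MemW f g r x ∧ wNorm x f (Ici 0) ≤ δ ∧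
    y = supNorm (iteratedDerivWithin k x (Ici 0)) (Ici 0)}

/-- A perfect `g`-spline of order `r` on `[0,∞)` with exactly `n` knots
`u 1 < ⋯ < u n` (and `u 0 = 0`), sign `ε`. -/
def PerfectSplineInf (g : ℝ → ℝ) (r n : ℕ) (u : ℕ → ℝ) (ε : ℝ) (Q : ℝ → ℝ) : Prop :=
  (ε = 1 ∨ ε = -1) ∧ u 0 = 0 ∧ (∀ i < n, u i < u (i + 1)) ∧
  ContDiffOn ℝ (r - 1 : ℕ) Q (Ici 0) ∧
  (∀ i < n, ContDiffOn ℝ (r : ℕ) Q (Ioo (u i) (u (i + 1))) ∧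
    ∀ s ∈ Ioo (u i) (u (i + 1)),
      iteratedDerivWithin r Q (Ioo (u i) (u (i + 1))) s = ε * (-1 : ℝ) ^ i * g s) ∧
  ContDiffOn ℝ (r : ℕ) Q (Ioi (u n)) ∧
  ∀ s ∈ Ioi (u n), iteratedDerivWithin r Q (Ioi (u n)) s = ε * (-1 : ℝ) ^ n * g s

end

def ZerosIn (S : Set ℝ) (h : ℝ → ℝ) (N : ℕ) : Prop :=
  ∃ p : ℕ → ℝ, (∀ i, i + 1 < N → p i < p (i + 1)) ∧ ∀ i, i < N → p i ∈ S ∧ h (p i) = 0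

lemma ZerosIn.mono {S T : Set ℝ} (hST : S ⊆ T) {h : ℝ → ℝ} {N : ℕ} (hz : ZerosIn S h N) :
    ZerosIn T h N := by
  obtain ⟨p, h1, h2⟩ := hz
  exact ⟨p, h1, fun i hi => ⟨hST (h2 i hi).1, (h2 i hi).2⟩⟩

lemma ZerosIn.between {a : ℝ} {h : ℝ → ℝ} {N : ℕ} {p : ℕ → ℝ}
    (hp : ∀ i, i < N + 1 → p i ∈ Icc 0 a)
    (hz : ∀ i, i < N → ∃ c ∈ Ioo (p i) (p (i + 1)), h c = 0) : ZerosIn (Ioo 0 a) h N := by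
  have hz' : ∀ i, ∃ c, i < N → c ∈ Ioo (p i) (p (i + 1)) ∧ h c = 0 := by
    intro i
    by_cases hi : i < N
    · obtain ⟨c, hc⟩ := hz i hi
      exact ⟨c, fun _ => hc⟩
    · exact ⟨0, fun h => absurd h hi⟩
  choose q hq using hz'
  refine ⟨q, fun i hi => ?_, fun i hi => ?_⟩
  · exact (hq i (by omega)).1.2.trans (hq (i + 1) hi).1.1
  · refine ⟨⟨?_, ?_⟩, (hq i hi).2⟩
    · exact (hp i (by omega)).1.trans_lt (hq i hi).1.1
    · exact (hq i hi).1.2.trans_le (hp (i + 1) (by omega)).2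

lemma ZerosIn.rolle {a : ℝ} {h h' : ℝ → ℝ} {N : ℕ} (hz : ZerosIn (Icc 0 a) h (N + 1))
    (hc : ContinuousOn h (Icc 0 a)) (hd : ∀ t ∈ Ioo 0 a, HasDerivAt h (h' t) t) :
    ZerosIn (Ioo 0 a) h' N := by
  obtain ⟨p, h1, h2⟩ := hz
  refine ZerosIn.between (p := p) (fun i hi => (h2 i hi).1) fun i hi => ?_
  have hA := h2 i (by omega)
  have hB := h2 (i + 1) (by omega)
  refine exists_hasDerivAt_eq_zero (h1 i (by omega)) (hc.mono (Icc_subset_Icc hA.1.1 hB.1.2))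
    (by rw [hA.2, hB.2]) fun t ht => hd t ⟨hA.1.1.trans_lt ht.1, ht.2.trans_le hB.1.2⟩

lemma ZerosIn.cons {a : ℝ} (ha : 0 < a) {h : ℝ → ℝ} {N : ℕ} (hz : ZerosIn (Ioo 0 a) h N)
    (h0 : h 0 = 0) : ZerosIn (Icc 0 a) h (N + 1) := by
  obtain ⟨p, h1, h2⟩ := hz
  refine ⟨fun i => match i with | 0 => 0 | j + 1 => p j, fun i hi => ?_, fun i hi => ?_⟩
  · cases i with
    | zero => exact (h2 0 (by omega)).1.1
    | succ j => exact h1 j (by omega)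
  · cases i with
    | zero => exact ⟨⟨le_rfl, ha.le⟩, h0⟩
    | succ j => exact ⟨Ioo_subset_Icc_self (h2 j (by omega)).1, (h2 j (by omega)).2⟩

lemma ZerosIn.strict {S : Set ℝ} {h : ℝ → ℝ} {N : ℕ} {p : ℕ → ℝ}
    (h1 : ∀ i, i + 1 < N → p i < p (i + 1)) : ∀ j, j < N → ∀ i, i < j → p i < p j := by
  intro j
  induction j with
  | zero => intro _ i hi; omega
  | succ j ih =>
    intro hj i hi
    rcases Nat.lt_succ_iff_lt_or_eq.1 hi with h | h
    · exact (ih (by omega) i h).trans (h1 j hj)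
    · subst h; exact h1 i hj

lemma exists_piece (u : ℕ → ℝ) (m : ℕ) (t : ℝ) (h0 : u 0 ≤ t) (h1 : t ≤ u (m + 1)) :
    ∃ i ≤ m, t ∈ Icc (u i) (u (i + 1)) := by
  induction m with
  | zero => exact ⟨0, le_rfl, h0, h1⟩
  | succ m ih =>
    rcases le_total t (u (m + 1)) with h | h
    · obtain ⟨i, hi, h⟩ := ih h
      exact ⟨i, by omega, h⟩
    · exact ⟨m + 1, le_rfl, h, h1⟩

lemma no_many_zeros {a : ℝ} {h : ℝ → ℝ} {n m : ℕ} (hmn : m ≤ n) {u : ℕ → ℝ} (hu0 : u 0 = 0)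
    (hu1 : u (m + 1) = a)
    (hinj : ∀ i ≤ m, ∀ s ∈ Icc (u i) (u (i + 1)), ∀ t ∈ Icc (u i) (u (i + 1)), s < t → h s ≠ h t) :
    ¬ ZerosIn (Icc 0 a) h (n + 2) := by
  rintro ⟨p, h1, h2⟩
  have hst := ZerosIn.strict (S := univ) (h := h) h1
  have hpc : ∀ j : Fin (n + 2), ∃ i : Fin (m + 1), p j ∈ Icc (u i) (u (i + 1)) := by
    intro j
    obtain ⟨i, hi, hh⟩ := exists_piece u m (p j) (by rw [hu0]; exact (h2 j j.2).1.1)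
      (by rw [hu1]; exact (h2 j j.2).1.2)
    exact ⟨⟨i, by omega⟩, hh⟩
  choose q hq using hpc
  obtain ⟨x, y, hxy, he⟩ := Fintype.exists_ne_map_eq_of_card_lt q (by simp; omega)
  rcases lt_or_gt_of_ne hxy with hl | hl
  · refine hinj (q x) (by omega) _ (hq x) _ (he ▸ hq y) (hst y y.2 x hl) ?_
    rw [(h2 x x.2).2, (h2 y y.2).2]
  · refine hinj (q x) (by omega) _ (he ▸ hq y) _ (hq x) (hst x x.2 y hl) ?_
    rw [(h2 x x.2).2, (h2 y y.2).2]

lemma core_chain {a : ℝ} (ha : 0 < a) {r n m k : ℕ} (hk2 : k < r) (hmn : m ≤ n)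
    {u : ℕ → ℝ} (hu0 : u 0 = 0) (hu1 : u (m + 1) = a) (D : ℕ → ℝ → ℝ)
    (hc : ∀ j < r, ContinuousOn (D j) (Icc 0 a))
    (hd : ∀ j, j + 1 < r → ∀ t ∈ Ioo 0 a, HasDerivAt (D j) (D (j + 1) t) t)
    (hz : ZerosIn (Ioo 0 a) (D 0) (n + r)) (hk0 : D k 0 = 0)
    (hinj : ∀ i ≤ m, ∀ s ∈ Icc (u i) (u (i + 1)), ∀ t ∈ Icc (u i) (u (i + 1)), s < t →
      D (r - 1) s ≠ D (r - 1) t) : False := by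
  have A : ∀ j, j ≤ k → ∀ M, M + j = n + r → ZerosIn (Ioo 0 a) (D j) M := by
    intro j
    induction j with
    | zero => intro _ M hM; obtain rfl : M = n + r := by omega
              exact hz
    | succ j ih =>
      intro hj M hM
      exact ((ih (by omega) (M + 1) (by omega)).mono Ioo_subset_Icc_self).rolle (hc j (by omega))
        (hd j (by omega))
  have B : ∀ i, k + i < r → ∀ M, M + (k + i) = n + r + 1 → ZerosIn (Icc 0 a) (D (k + i)) M := by
    intro i
    induction i with
    | zero =>
      intro _ M hM
      obtain ⟨M', rfl⟩ : ∃ M', M = M' + 1 := ⟨M - 1, by omega⟩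
      exact (A k le_rfl M' (by omega)).cons ha hk0
    | succ i ih =>
      intro hj M hM
      exact ((ih (by omega) (M + 1) (by omega)).rolle (hc (k + i) (by omega))
        (hd (k + i) (by omega))).mono Ioo_subset_Icc_self
  have := B (r - 1 - k) (by omega) (n + 2) (by omega)
  rw [show k + (r - 1 - k) = r - 1 by omega] at this
  exact no_many_zeros hmn hu0 hu1 hinj this

lemma hasDerivAt_chain {s : Set ℝ} (hs : UniqueDiffOn ℝ s) {N : ℕ} {x : ℝ → ℝ}
    (hx : ContDiffOn ℝ N x s) {j : ℕ} (hj : j < N) {t : ℝ} (ht : s ∈ 𝓝 t) :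
    HasDerivAt (iteratedDerivWithin j x s) (iteratedDerivWithin (j + 1) x s t) t := by
  have h1 := hx.differentiableOn_iteratedDerivWithin (m := j) (by exact_mod_cast hj) hs t
    (mem_of_mem_nhds ht)
  rw [iteratedDerivWithin_succ]
  exact h1.hasDerivWithinAt.hasDerivAt ht

lemma itDW_eq_of_mem_nhds {s : Set ℝ} {x : ℝ → ℝ} (j : ℕ) {t : ℝ} (ht : s ∈ 𝓝 t) :
    iteratedDerivWithin j x s t = iteratedDeriv j x t := by
  rw [← iteratedDerivWithin_univ, iteratedDerivWithin, iteratedDerivWithin,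
    iteratedFDerivWithin_congr_set (Filter.eventuallyEq_univ.mpr ht)]

lemma spline_incr {g G : ℝ → ℝ} {r m : ℕ} {a ε : ℝ} {u : ℕ → ℝ} (hr : 1 ≤ r) (ha : 0 < a)
    (hg_c : ContinuousOn g (Ici 0))
    (hS : PerfectSplineWith g r a m u ε G) (hu : ∀ i ≤ m + 1, u i ∈ Icc 0 a)
    {i : ℕ} (hi : i ≤ m) {s t : ℝ} (hs : u i ≤ s) (hst : s < t) (ht : t ≤ u (i + 1)) :
    iteratedDerivWithin (r - 1) G (Icc 0 a) t - iteratedDerivWithin (r - 1) G (Icc 0 a) s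
      = ε * (-1) ^ i * ∫ v in s..t, g v := by
  obtain ⟨hε, -, -, -, hcd, hp⟩ := hS
  have h0 := (hu i (by omega)).1
  have h1 := (hu (i + 1) (by omega)).2
  rw [← intervalIntegral.integral_const_mul]
  symm
  apply intervalIntegral.integral_eq_sub_of_hasDerivAt_of_le hst.le
  · exact (hcd.continuousOn_iteratedDerivWithin le_rfl (uniqueDiffOn_Icc ha)).mono
      (Icc_subset_Icc (h0.trans hs) (ht.trans h1))
  · intro v hv
    have hv' : v ∈ Ioo (u i) (u (i + 1)) := ⟨hs.trans_lt hv.1, hv.2.trans_le ht⟩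
    have hn : Ioo (u i) (u (i + 1)) ∈ 𝓝 v := isOpen_Ioo.mem_nhds hv'
    rw [← (hp i hi).2 v hv']
    obtain ⟨q, rfl⟩ : ∃ q, r = q + 1 := ⟨r - 1, by omega⟩
    have := hasDerivAt_chain isOpen_Ioo.uniqueDiffOn (hp i hi).1 (Nat.lt_succ_self q) hn
    refine this.congr_of_eventuallyEq ?_
    filter_upwards [hn] with w hw
    rw [itDW_eq_of_mem_nhds _ (isOpen_Ioo.mem_nhds hw), Nat.add_sub_cancel,
      itDW_eq_of_mem_nhds _ (Icc_mem_nhds (h0.trans_lt hw.1) (hw.2.trans_le h1))]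
  · apply ContinuousOn.intervalIntegrable
    rw [uIcc_of_le hst.le]
    exact (hg_c.mono fun v hv => (h0.trans hs).trans hv.1).const_mul _

lemma core_bound
    (f g : ℝ → ℝ)
    (hf_pos : ∀ t ∈ Ici (0:ℝ), 0 < f t)
    (hf_anti : AntitoneOn f (Ici 0))
    (hg_c : ContinuousOn g (Ici 0)) (hg_pos : ∀ t ∈ Ici (0:ℝ), 0 < g t)
    (hg_anti : AntitoneOn g (Ici 0))
    (r : ℕ) (hr : 1 ≤ r) (n : ℕ) (a : ℝ) (ha : 0 < a)
    (G : ℝ → ℝ) (hG : IsExtremalSpline f g r n a G)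
    (k : ℕ) (hk2 : k < r) (x : ℝ → ℝ) (hx : MemW f g r x) (hδ : 0 < wNorm G f (Icc 0 a))
    (hxb : ∀ t ∈ Ici (0:ℝ), |x t| ≤ wNorm G f (Icc 0 a) * f t) (τ : ℝ) (hτ : 0 ≤ τ) :
    |iteratedDerivWithin k x (Ici 0) τ| ≤ |iteratedDerivWithin k G (Icc 0 a) 0| := by
  by_contra hcon
  push Not at hcon
  obtain ⟨⟨m, hmn, u, ε, hS⟩, b, hb1, hb2, hb3, hb4⟩ := hG
  obtain ⟨-, hxc, -, hxi⟩ := hx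
  have hS' := hS
  obtain ⟨hε, hu0, hu1, hu, hcd, -⟩ := hS'
  set δ := wNorm G f (Icc 0 a)
  have hxk : iteratedDerivWithin k x (Ici 0) τ ≠ 0 := by
    intro h; rw [h, abs_zero] at hcon; exact absurd hcon (abs_nonneg _).not_gt
  set c := iteratedDerivWithin k G (Icc 0 a) 0 / iteratedDerivWithin k x (Ici 0) τ with hc
  have hc1 : |c| < 1 := by
    rw [hc, abs_div, div_lt_one (abs_pos.2 hxk)]; exact hcon
  have huI : ∀ i ≤ m + 1, u i ∈ Icc 0 a := by
    have hst := ZerosIn.strict (S := univ) (h := g) (N := m + 2) (p := u)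
      (fun i hi => hu i (by omega))
    intro i hi
    constructor
    · rcases Nat.eq_zero_or_pos i with h | h
      · rw [h, hu0]
      · rw [← hu0]; exact (hst i (by omega) 0 h).le
    · rcases Nat.lt_or_eq_of_le hi with h | h
      · rw [← hu1]; exact (hst (m + 1) (by omega) i h).le
      · rw [h, hu1]
  have hst := ZerosIn.strict (S := univ) (h := g) (N := n + r + 1) (p := fun i => b (i + 1))
      (fun i hi => hb3 (i + 1) (by omega) (by omega))
  have hbI : ∀ i, i < n + r + 1 → b (i + 1) ∈ Icc 0 a := by
    intro i hi
    constructor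
    · rcases Nat.eq_zero_or_pos i with h | h
      · rw [h]; exact hb1
      · exact hb1.trans (hst i hi 0 h).le
    · rcases Nat.lt_or_eq_of_le (Nat.le_of_lt_succ hi) with h | h
      · rw [← hb2]; exact (hst (n + r) (by omega) i h).le
      · rw [h, hb2]
  have hshift : MapsTo (fun s => s + τ) (Icc 0 a) (Ici 0) := fun s hs => add_nonneg hs.1 hτ
  have hudI : UniqueDiffOn ℝ (Icc (0:ℝ) a) := uniqueDiffOn_Icc ha
  have hudJ : UniqueDiffOn ℝ (Ici (0:ℝ)) := uniqueDiffOn_Ici 0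
  let D : ℕ → ℝ → ℝ := fun j s =>
    iteratedDerivWithin j G (Icc 0 a) s - c * iteratedDerivWithin j x (Ici 0) (s + τ)
  have hDc : ∀ j < r, ContinuousOn (D j) (Icc 0 a) := by
    intro j hj
    have hj' : ((j : ℕ) : WithTop ℕ∞) ≤ ((r - 1 : ℕ) : WithTop ℕ∞) := by
      exact_mod_cast (by omega : j ≤ r - 1)
    refine (hcd.continuousOn_iteratedDerivWithin hj' hudI).sub (ContinuousOn.const_mul ?_ c)
    exact (hxc.continuousOn_iteratedDerivWithin hj' hudJ).comp (by fun_prop) hshift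
  refine core_chain ha hk2 hmn hu0 hu1 D hDc ?_ ?_ ?_ ?_
  · intro j hj t ht
    refine (hasDerivAt_chain hudI hcd (by omega) (Icc_mem_nhds ht.1 ht.2)).sub
      (HasDerivAt.const_mul c ?_)
    have := hasDerivAt_chain hudJ hxc (j := j) (by omega) (t := t + τ)
      (Ici_mem_nhds (by linarith [ht.1]))
    exact this.comp_add_const t τ
  · refine ZerosIn.between (p := fun i => b (i + 1)) hbI fun i hi => ?_
    have key : ∀ i, i < n + r + 1 → |c * x (b (i + 1) + τ)| < δ * f (b (i + 1)) := by
      intro i hi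
      have hbi := (hbI i hi).1
      have hp : 0 < δ * f (b (i + 1)) := mul_pos hδ (hf_pos _ hbi)
      have h1 := hxb (b (i + 1) + τ) (add_nonneg hbi hτ)
      have h2 := hf_anti (a := b (i + 1)) (b := b (i + 1) + τ) hbi (add_nonneg hbi hτ) (by linarith)
      have h3 : |x (b (i + 1) + τ)| ≤ δ * f (b (i + 1)) := h1.trans (by gcongr)
      rw [abs_mul]
      calc |c| * |x (b (i + 1) + τ)| ≤ |c| * (δ * f (b (i + 1))) := by gcongr
        _ < 1 * (δ * f (b (i + 1))) := by gcongr
        _ = _ := one_mul _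
    have hA := abs_lt.1 (key i (by omega))
    have hB := abs_lt.1 (key (i + 1) (by omega))
    have eA := hb4 (i + 1) (by omega) (by omega)
    have eB := hb4 (i + 1 + 1) (by omega) (by omega)
    have hlt := hb3 (i + 1) (by omega) (by omega)
    have hcI := (hDc 0 (by omega)).mono
      (Icc_subset_Icc (hbI i (by omega)).1 (hbI (i + 1) (by omega)).2)
    have hD0 : ∀ s, D 0 s = G s - c * x (s + τ) := by intro s; simp [D]
    rw [show i + 1 + 1 + r + 1 = (i + 1 + r + 1) + 1 by ring, pow_succ] at eB
    rcases neg_one_pow_eq_or ℝ (i + 1 + r + 1) with h | h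
    · rw [h] at eA eB
      obtain ⟨z, hz, hz0⟩ := intermediate_value_Ioo' hlt.le hcI
        (show (0:ℝ) ∈ Ioo _ _ from ⟨by rw [hD0, eB]; linarith, by rw [hD0, eA]; linarith⟩)
      exact ⟨z, hz, hz0⟩
    · rw [h] at eA eB
      obtain ⟨z, hz, hz0⟩ := intermediate_value_Ioo hlt.le hcI
        (show (0:ℝ) ∈ Ioo _ _ from ⟨by rw [hD0, eA]; linarith, by rw [hD0, eB]; linarith⟩)
      exact ⟨z, hz, hz0⟩
  · simp only [D, zero_add, hc]
    field_simp
    ring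
  · intro i hi s hs t ht hst' heq
    have h0 : 0 ≤ s := (huI i (by omega)).1.trans hs.1
    have e1 := spline_incr hr ha hg_c hS huI hi hs.1 hst' ht.2
    have e2 := hxi (s + τ) (t + τ) (by linarith) (by linarith)
    have hgi : ∀ p q : ℝ, 0 ≤ p → p ≤ q → IntervalIntegrable g volume p q := by
      intro p q hp hpq
      apply ContinuousOn.intervalIntegrable
      rw [uIcc_of_le hpq]
      exact hg_c.mono fun v hv => hp.trans hv.1
    have e3 : ∫ v in (s + τ)..(t + τ), g v ≤ ∫ v in s..t, g v := by
      rw [← intervalIntegral.integral_comp_add_right]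
      apply intervalIntegral.integral_mono_on hst'.le
      · apply ContinuousOn.intervalIntegrable
        rw [uIcc_of_le hst'.le]
        refine hg_c.comp (by fun_prop) fun v hv => ?_
        exact add_nonneg (h0.trans hv.1) hτ
      · exact hgi s t h0 hst'.le
      · intro v hv
        exact hg_anti (h0.trans hv.1) (add_nonneg (h0.trans hv.1) hτ) (by linarith)
    have e4 : 0 < ∫ v in s..t, g v :=
      intervalIntegral.intervalIntegral_pos_of_pos_on (hgi s t h0 hst'.le)
        (fun v hv => hg_pos v (h0.trans hv.1.le)) hst'
    have e5 : iteratedDerivWithin (r - 1) G (Icc 0 a) t - iteratedDerivWithin (r - 1) G (Icc 0 a) s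
        = c * (iteratedDerivWithin (r - 1) x (Ici 0) (t + τ)
          - iteratedDerivWithin (r - 1) x (Ici 0) (s + τ)) := by
      simp only [D] at heq
      linarith
    rw [e1] at e5
    have e6 := congrArg abs e5
    have hε1 : |ε| = 1 := by rcases hε with h | h <;> simp [h]
    rw [abs_mul, abs_mul, abs_mul, hε1, abs_pow, abs_neg, abs_one, one_pow, abs_of_pos e4] at e6
    have e7 : |c| * |iteratedDerivWithin (r - 1) x (Ici 0) (t + τ)
          - iteratedDerivWithin (r - 1) x (Ici 0) (s + τ)| ≤ |c| * ∫ v in s..t, g v := by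
      gcongr
      exact e2.trans e3
    have e8 : |c| * ∫ v in s..t, g v < 1 * ∫ v in s..t, g v := by gcongr
    linarith

/-- Theorem 2: with δ := ‖G_{r,n,f,a}‖_{C[0,a],f}, every x ∈ W^r_{f,g}(ℝ₊) with
‖x‖_{C[0,∞),f} ≤ δ satisfies ‖x^{(k)}‖_{C[0,∞)} ≤ ‖G_{r,n,f,a}^{(k)}‖_{C[0,a]};
that is, ω(D^k, δ) ≤ ‖G_{r,n,f,a}^{(k)}‖_{C[0,a]}. -/
theorem statement3
    (f g : ℝ → ℝ)
    (hf_c : ContinuousOn f (Ici 0)) (hf_pos : ∀ t ∈ Ici (0:ℝ), 0 < f t)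
    (hf_anti : AntitoneOn f (Ici 0))
    (hg_c : ContinuousOn g (Ici 0)) (hg_pos : ∀ t ∈ Ici (0:ℝ), 0 < g t)
    (hg_anti : AntitoneOn g (Ici 0))
    (r : ℕ) (hr : 1 ≤ r) (n : ℕ) (a : ℝ) (ha : 0 < a)
    (G : ℝ → ℝ) (hG : IsExtremalSpline f g r n a G)
    (k : ℕ) (hk1 : 1 ≤ k) (hk2 : k < r) :
    (∀ x : ℝ → ℝ, MemW f g r x → wNorm x f (Ici 0) ≤ wNorm G f (Icc 0 a) →
      ∀ t ∈ Ici (0:ℝ), |iteratedDerivWithin k x (Ici 0) t| ≤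
        supNorm (iteratedDerivWithin k G (Icc 0 a)) (Icc 0 a)) ∧
    omegaD f g r k (wNorm G f (Icc 0 a)) ≤
      supNorm (iteratedDerivWithin k G (Icc 0 a)) (Icc 0 a) := by
  have hnn : 0 ≤ wNorm G f (Icc 0 a) := by
    apply Real.sSup_nonneg
    rintro _ ⟨t, ht, rfl⟩
    exact div_nonneg (abs_nonneg _) (hf_pos t ht.1).le
  have hnn2 : 0 ≤ supNorm (iteratedDerivWithin k G (Icc 0 a)) (Icc 0 a) := by
    apply Real.sSup_nonneg
    rintro _ ⟨t, ht, rfl⟩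
    exact abs_nonneg _
  have main : ∀ x : ℝ → ℝ, MemW f g r x → wNorm x f (Ici 0) ≤ wNorm G f (Icc 0 a) →
      ∀ t ∈ Ici (0:ℝ), |iteratedDerivWithin k x (Ici 0) t| ≤
        supNorm (iteratedDerivWithin k G (Icc 0 a)) (Icc 0 a) := by
    intro x hx hxn t ht
    have hxb : ∀ t ∈ Ici (0:ℝ), |x t| ≤ wNorm G f (Icc 0 a) * f t := by
      intro t ht
      rw [← div_le_iff₀ (hf_pos t ht)]
      exact (le_csSup hx.2.2.1 (mem_image_of_mem _ ht)).trans hxn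
    rcases hnn.eq_or_lt with h0 | h0
    · have hx0 : EqOn x (fun _ => (0:ℝ)) (Ici 0) := by
        intro s hs
        have := hxb s hs
        rw [← h0, zero_mul] at this
        exact abs_nonpos_iff.1 this
      rw [iteratedDerivWithin_congr hx0 ht]
      simpa using hnn2
    · refine (core_bound f g hf_pos hf_anti hg_c hg_pos hg_anti r hr n a ha G hG k hk2 x hx h0 hxb
        t ht).trans ?_
      obtain ⟨⟨m, -, u, ε, -, -, -, -, hcd, -⟩, -⟩ := hG
      have hc : ContinuousOn (iteratedDerivWithin k G (Icc 0 a)) (Icc 0 a) :=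
        hcd.continuousOn_iteratedDerivWithin (by exact_mod_cast (by omega : k ≤ r - 1))
          (uniqueDiffOn_Icc ha)
      refine le_csSup ?_ (mem_image_of_mem (fun t => |iteratedDerivWithin k G (Icc 0 a) t|)
        (⟨le_rfl, ha.le⟩ : (0:ℝ) ∈ Icc 0 a))
      exact isCompact_Icc.bddAbove_image hc.abs
  refine ⟨main, ?_⟩
  refine Real.sSup_le ?_ hnn2
  rintro _ ⟨x, hx, hxn, rfl⟩
  refine Real.sSup_le ?_ hnn2
  rintro _ ⟨t, ht, rfl⟩
  exact main x hx hxn t ht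
end

section
/- Let f and g be continuous, positive, non-increasing functions on [0,∞), let r ∈ ℕ, n ∈ ℤ₊. Then φ_{r,n,f}(∞) := lim_{a→∞} φ_{r,n,f}(a) is finite if and only if both of the following hold: (6) A_0 := ∫_0^∞ g(t) dt < ∞ and A_k := ∫_0^∞ [ Σ_{s=0}^{k−1} (−1)^{k−s−1} A_s t^{k−s−1}/(k−s−1)! + (−1)^k g_k(t) ] dt < ∞ for k = 1, …, r−1; and (7) sup_{t∈[0,∞)} |Σ_{s=0}^{r−1} (−1)^{r−s−1} A_s t^{r−s−1}/(r−s−1)! + (−1)^r g_r(t)| / f(t) < ∞. -/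
open Set Filter MeasureTheory
open scoped Topology

/-- alternation lemma -/
lemma alt_deriv (a : ℝ) (D : ℕ → ℝ → ℝ) (q : ℕ)
    (hc : ∀ j ≤ q, ContinuousOn (D j) (Icc 0 a))
    (hd : ∀ j < q, ∀ s ∈ Ioo 0 a, HasDerivAt (D j) (D (j+1) s) s) (N : ℕ) (b : ℕ → ℝ) (σ : ℝ)
    (hb : ∀ i ≤ N + q, b i ∈ Icc 0 a) (hbm : ∀ i < N + q, b i < b (i+1))
    (hs : ∀ i ≤ N + q, 0 < σ * (-1 : ℝ)^i * D 0 (b i)) :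
    ∃ c : ℕ → ℝ, ∃ τ : ℝ, (∀ i ≤ N, c i ∈ Icc 0 a) ∧ (∀ i < N, c i < c (i+1)) ∧
      ∀ i ≤ N, 0 < τ * (-1 : ℝ)^i * D q (c i) := by
  induction q generalizing D b σ with
  | zero => exact ⟨b, σ, hb, hbm, hs⟩
  | succ q ih =>
    have key : ∀ i, ∃ c, i ≤ N + q → c ∈ Ioo (b i) (b (i+1)) ∧
        0 < (-σ) * (-1 : ℝ)^i * D 1 c := by
      intro i
      by_cases hi : i ≤ N + q
      · have h1 := hb i (by omega)
        have h2 := hb (i+1) (by omega)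
        have hlt := hbm i (by omega)
        have hsub : Icc (b i) (b (i+1)) ⊆ Icc 0 a := Icc_subset_Icc h1.1 h2.2
        obtain ⟨c, hc1, hc2⟩ := exists_hasDerivAt_eq_slope (D 0) (D 1) hlt
          ((hc 0 (by omega)).mono hsub)
          (fun x hx => hd 0 (by omega) x ⟨h1.1.trans_lt hx.1, hx.2.trans_le h2.2⟩)
        refine ⟨c, fun _ => ⟨hc1, ?_⟩⟩
        have e1 := hs i (by omega)
        have e2 := hs (i+1) (by omega)
        rw [hc2, mul_div_assoc']
        apply div_pos _ (sub_pos.2 hlt)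
        rw [pow_succ] at e2
        nlinarith
      · exact ⟨0, fun h => absurd h hi⟩
    choose c hcc using key
    apply ih (fun j => D (j+1)) (fun j hj => hc (j+1) (by omega))
      (fun j hj => hd (j+1) (by omega)) c (-σ)
    · intro i hi
      have := (hcc i hi).1
      exact ⟨(hb i (by omega)).1.trans this.1.le, this.2.le.trans (hb (i+1) (by omega)).2⟩
    · intro i hi
      exact (hcc i (by omega)).1.2.trans (hcc (i+1) (by omega)).1.1
    · intro i hi
      exact (hcc i hi).2

lemma gk_eqOn {g G : ℝ → ℝ} (h : EqOn g G (Ici 0)) (k : ℕ) : EqOn (gk g k) (gk G k) (Ici 0) := by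
  induction k with
  | zero => exact h
  | succ k ih =>
    intro t ht
    simp only [gk]
    apply intervalIntegral.integral_congr
    intro s hs
    rw [uIcc_of_le ht] at hs
    exact ih hs.1

lemma gext_cont {g : ℝ → ℝ} (hg : ContinuousOn g (Ici 0)) : Continuous (fun t => g (max t 0)) :=
  hg.comp_continuous (by fun_prop) (fun t => le_max_right t 0)

lemma gk_cont {g : ℝ → ℝ} (hg : Continuous g) (k : ℕ) : Continuous (gk g k) := by
  induction k with
  | zero => exact hg
  | succ k ih =>
    exact intervalIntegral.continuous_primitive (fun a b => ih.intervalIntegrable a b) 0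

lemma gext_eqOn (g : ℝ → ℝ) : EqOn g (fun t => g (max t 0)) (Ici 0) := by
  intro t ht
  simp [max_eq_left (mem_Ici.1 ht)]

lemma gk_contOn {g : ℝ → ℝ} (hg : ContinuousOn g (Ici 0)) (k : ℕ) :
    ContinuousOn (gk g k) (Ici 0) :=
  (gk_cont (gext_cont hg) k).continuousOn.congr (gk_eqOn (gext_eqOn g) k)

lemma gk_deriv {g : ℝ → ℝ} (hg : ContinuousOn g (Ici 0)) (k : ℕ) (t : ℝ) (ht : 0 < t) :
    HasDerivAt (gk g (k+1)) (gk g k t) t := by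
  have h := gk_cont (gext_cont hg) k
  have h1 : HasDerivAt (gk (fun t => g (max t 0)) (k+1)) (gk (fun t => g (max t 0)) k t) t :=
    intervalIntegral.integral_hasDerivAt_right (h.intervalIntegrable _ _)
      h.aestronglyMeasurable.stronglyMeasurableAtFilter h.continuousAt
  rw [gk_eqOn (gext_eqOn g) k ht.le]
  refine h1.congr_of_eventuallyEq ?_
  filter_upwards [Ioi_mem_nhds ht] with s hs
  exact gk_eqOn (gext_eqOn g) (k+1) (mem_Ioi.1 hs).le

lemma Pfun_contOn {g : ℝ → ℝ} (hg : ContinuousOn g (Ici 0)) (k : ℕ) :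
    ContinuousOn (Pfun g k) (Ici 0) := by
  unfold Pfun
  refine ContinuousOn.add (Continuous.continuousOn (by fun_prop)) ?_
  exact continuousOn_const.mul (gk_contOn hg k)

lemma Pfun_deriv {g : ℝ → ℝ} (hg : ContinuousOn g (Ici 0)) (k : ℕ) (t : ℝ) (ht : 0 < t) :
    HasDerivAt (Pfun g (k+1)) (- Pfun g k t) t := by
  unfold Pfun
  have h2 := (gk_deriv hg k t ht).const_mul ((-1:ℝ)^(k+1))
  have h1 : HasDerivAt (fun t : ℝ => ∑ s : Fin (k+1), (-1 : ℝ) ^ (k + 1 - 1 - s.1) * Acoef g s.1 * t ^ (k +1 - 1 - s.1) /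
    (Nat.factorial (k + 1 - 1 - s.1) : ℝ)) (∑ s : Fin (k+1), (-1 : ℝ) ^ (k + 1 - 1 - s.1) * Acoef g s.1 * (((k +1 - 1 - s.1 : ℕ):ℝ) * t ^ (k +1 - 1 - s.1 - 1)) /
    (Nat.factorial (k + 1 - 1 - s.1) : ℝ)) t := by
    apply HasDerivAt.fun_sum
    intro i _
    exact ((hasDerivAt_pow _ t).const_mul _).div_const _
  refine (h1.add h2).congr_deriv ?_
  symm
  rw [Fin.sum_univ_castSucc]
  simp only [Fin.val_castSucc, Fin.val_last]
  rw [neg_add, ← Finset.sum_neg_distrib]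
  have : ∀ s : Fin k, -((-1 : ℝ) ^ (k - 1 - s.1) * Acoef g s.1 * t ^ (k - 1 - s.1) /
    (Nat.factorial (k - 1 - s.1) : ℝ)) = (-1 : ℝ) ^ (k + 1 - 1 - s.1) * Acoef g s.1 * (((k +1 - 1 - s.1 : ℕ):ℝ) * t ^ (k +1 - 1 - s.1 - 1)) /
    (Nat.factorial (k + 1 - 1 - s.1) : ℝ) := by
    intro s
    obtain ⟨d, hd⟩ : ∃ d, k = s.1 + d + 1 := ⟨k - s.1 - 1, by omega⟩
    have e1 : k - 1 - s.1 = d := by omega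
    have e2 : k + 1 - 1 - s.1 = d + 1 := by omega
    rw [e1, e2, Nat.factorial_succ]
    push_cast
    have : (d.factorial : ℝ) ≠ 0 := by positivity
    have : (d + 1 : ℝ) ≠ 0 := by positivity
    field_simp
    ring
  rw [Finset.sum_congr rfl (fun s _ => this s)]
  simp
  ring

lemma gk_zero (g : ℝ → ℝ) (k : ℕ) : gk g (k+1) 0 = 0 := by simp [gk]

lemma Pfun_zero (g : ℝ → ℝ) (k : ℕ) : Pfun g (k+1) 0 = Acoef g k := by
  unfold Pfun
  rw [gk_zero, Fin.sum_univ_castSucc, Finset.sum_eq_zero]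
  · simp
  · intro s _
    have : k + 1 - 1 - s.castSucc.1 ≠ 0 := by simp; omega
    rw [zero_pow this]; simp

lemma Acoef_eq (g : ℝ → ℝ) (k : ℕ) : Acoef g k = ∫ t in Ioi (0:ℝ), Pfun g k t := by
  cases k with
  | zero => simp [Acoef, Pfun, gk]
  | succ k => simp [Acoef, Pfun]

lemma Pfun_succ {g : ℝ → ℝ} (hg : ContinuousOn g (Ici 0)) (k : ℕ) (t : ℝ) (ht : 0 ≤ t) :
    Pfun g (k+1) t = Acoef g k - ∫ s in (0:ℝ)..t, Pfun g k s := by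
  have hc : ContinuousOn (fun s => Pfun g k s) (uIcc 0 t) :=
    (Pfun_contOn hg k).mono (by rw [uIcc_of_le ht]; exact Icc_subset_Ici_self)
  have := intervalIntegral.integral_eq_sub_of_hasDerivAt_of_le ht
    ((Pfun_contOn hg (k+1)).mono Icc_subset_Ici_self)
    (fun x hx => Pfun_deriv hg k x hx.1) hc.neg.intervalIntegrable
  rw [intervalIntegral.integral_neg, Pfun_zero] at this
  linarith

lemma itd_hasDeriv {G : ℝ → ℝ} {S : Set ℝ} (hS : UniqueDiffOn ℝ S) {q j : ℕ} (hj : j < q)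
    (hG : ContDiffOn ℝ q G S) {s : ℝ} (hs : S ∈ 𝓝 s) :
    HasDerivAt (iteratedDerivWithin j G S) (iteratedDerivWithin (j+1) G S s) s := by
  have h := hG.differentiableOn_iteratedDerivWithin (m := j) (by exact_mod_cast hj) hS
  have h2 := (h s (mem_of_mem_nhds hs)).hasDerivWithinAt
  rw [← iteratedDerivWithin_succ] at h2
  exact h2.hasDerivAt hs

lemma itd_eq {G : ℝ → ℝ} {S T : Set ℝ} {s : ℝ} (hS : S ∈ 𝓝 s) (hT : T ∈ 𝓝 s) (j : ℕ) :
    iteratedDerivWithin j G S s = iteratedDerivWithin j G T s := by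
  unfold iteratedDerivWithin
  rw [iteratedFDerivWithin_congr_set]
  exact (eventuallyEq_univ.2 hS).trans (eventuallyEq_univ.2 hT).symm

lemma wn_le {f G : ℝ → ℝ} {a : ℝ} (hf_c : ContinuousOn f (Ici 0)) (hf_pos : ∀ t ∈ Ici (0:ℝ), 0 < f t)
    (hG : ContinuousOn G (Icc 0 a)) {t : ℝ} (ht : t ∈ Icc 0 a) :
    |G t| ≤ wNorm G f (Icc 0 a) * f t := by
  rw [← div_le_iff₀ (hf_pos t ht.1)]
  apply le_csSup
  · apply IsCompact.bddAbove
    apply isCompact_Icc.image_of_continuousOn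
    exact hG.abs.div (hf_c.mono Icc_subset_Ici_self) (fun x hx => (hf_pos x hx.1).ne')
  · exact mem_image_of_mem _ ht

/-- upper bound for the norm of extremal spline -/
lemma upper (f g : ℝ → ℝ)
    (hf_pos : ∀ t ∈ Ici (0:ℝ), 0 < f t)
    (hg_c : ContinuousOn g (Ici 0)) (hg_pos : ∀ t ∈ Ici (0:ℝ), 0 < g t)
    (r : ℕ) (hr : 1 ≤ r) (n : ℕ) (a : ℝ) (ha : 0 < a) (G : ℝ → ℝ)
    (hG : IsExtremalSpline f g r n a G) (C : ℝ) (hC : ∀ t ∈ Ici (0:ℝ), |Pfun g r t| ≤ C * f t) :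
    wNorm G f (Icc 0 a) ≤ C := by
  by_contra! hlt
  obtain ⟨⟨m, hm, u, ε, hε, hu0, hua, hu, hGc, hGp⟩, b, hb1, hba, hbm, hb⟩ := hG
  obtain ⟨q, rfl⟩ : ∃ q, r = q + 1 := ⟨r - 1, by omega⟩
  simp only [Nat.add_sub_cancel] at hGc
  have hε2 : ε * ε = 1 := by rcases hε with rfl | rfl <;> norm_num
  set δ : ℝ := ε * (-1)^(q+1) with hδ
  have hδa : |δ| = 1 := by rcases hε with h | h <;> simp [hδ, h]
  have hU := uniqueDiffOn_Icc ha
  set D : ℕ → ℝ → ℝ := fun j s => iteratedDerivWithin j G (Icc 0 a) s -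
    δ * (-1)^j * Pfun g (q+1-j) s with hD
  have hDc : ∀ j ≤ q, ContinuousOn (D j) (Icc 0 a) := by
    intro j hj
    refine ContinuousOn.sub (hGc.continuousOn_iteratedDerivWithin (by exact_mod_cast hj) hU) ?_
    exact continuousOn_const.mul ((Pfun_contOn hg_c _).mono Icc_subset_Ici_self)
  have hDd : ∀ j < q, ∀ s ∈ Ioo 0 a, HasDerivAt (D j) (D (j+1) s) s := by
    intro j hj s hs
    have h1 := itd_hasDeriv hU hj hGc (Icc_mem_nhds hs.1 hs.2)
    have h2 := (Pfun_deriv hg_c (q - j) s hs.1).const_mul (δ * (-1)^j)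
    have e1 : q + 1 - j = q - j + 1 := by omega
    have e2 : q + 1 - (j + 1) = q - j := by omega
    have := h1.sub h2
    simp only [hD, e1, e2]
    refine this.congr_deriv ?_
    rw [pow_succ]; ring
  have hbI : ∀ i, 1 ≤ i → i ≤ n + (q+1) + 1 → b i ∈ Icc 0 a := by
    have A : ∀ i, 1 ≤ i → i ≤ n + (q+1) + 1 → 0 ≤ b i := by
      intro i hi
      induction i, hi using Nat.le_induction with
      | base => intro _; exact hb1
      | succ i hi ih => intro h; exact (ih (by omega)).trans (hbm i hi (by omega)).le
    have B : ∀ d, ∀ i, 1 ≤ i → i + d = n + (q+1) + 1 → b i ≤ a := by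
      intro d
      induction d with
      | zero => intro i _ h; rw [← hba, ← h]; simp
      | succ d ih => intro i hi h; exact (hbm i hi (by omega)).le.trans (ih (i+1) (by omega) (by omega))
    exact fun i h1 h2 => ⟨A i h1 h2, B (n + (q+1) + 1 - i) i h1 (by omega)⟩
  obtain ⟨c, τ, hcI, hcm, hcs⟩ := alt_deriv a D q hDc hDd (n+1) (fun i => b (i+1)) ((-1)^(q+1))
    (fun i hi => hbI _ (by omega) (by omega)) (fun i hi => hbm _ (by omega) (by omega)) (by
      intro i hi
      have h1 := hb (i+1) (by omega) (by omega)
      have hI := hbI (i+1) (by omega) (by omega)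
      have h2 := hC (b (i+1)) hI.1
      have h3 := hf_pos _ hI.1
      simp only [hD, iteratedDerivWithin_zero, pow_zero, mul_one, Nat.sub_zero, h1]
      have h4 : |(-1)^(q+1) * (-1:ℝ)^i * (δ * Pfun g (q+1) (b (i+1)))| ≤ C * f (b (i+1)) := by
        rw [abs_mul, abs_mul, abs_mul, hδa]; simpa using h2
      have h5 : C * f (b (i+1)) < wNorm G f (Icc 0 a) * f (b (i+1)) := by gcongr
      have h6 : (-1)^(q+1) * (-1:ℝ)^i * ((-1) ^ (i + 1 + (q + 1) + 1) * (wNorm G f (Icc 0 a) * f (b (i + 1)))) = wNorm G f (Icc 0 a) * f (b (i + 1)) := by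
        have : (-1)^(q+1) * (-1:ℝ)^i * (-1) ^ (i + 1 + (q + 1) + 1) = 1 := by
          rw [← pow_add, ← pow_add]; exact Even.neg_one_pow ⟨i + q + 2, by omega⟩
        rw [← mul_assoc, this, one_mul]
      rw [mul_sub, h6]
      linarith [le_abs_self ((-1)^(q+1) * (-1:ℝ)^i * (δ * Pfun g (q+1) (b (i+1))))])
  -- derivative of the last one
  have huI : ∀ i ≤ m, 0 ≤ u i ∧ u (i+1) ≤ a := by
    intro i hi
    constructor
    · have A : ∀ i, i ≤ m → 0 ≤ u i := by
        intro i
        induction i with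
        | zero => intro _; exact hu0.ge
        | succ i ih => intro h; exact (ih (by omega)).trans (hu i (by omega)).le
      exact A i hi
    · have B : ∀ d, ∀ i, i + d = m → u (i+1) ≤ a := by
        intro d
        induction d with
        | zero => intro i h; rw [← hua, ← h]
        | succ d ih => intro i h; exact (hu (i+1) (by omega)).le.trans (ih (i+1) (by omega))
      exact B (m - i) i (by omega)
  have hlast : ∀ i ≤ m, ∀ s ∈ Ioo (u i) (u (i+1)),
      HasDerivAt (fun s => -ε * D q s) ((1 - (-1)^i) * g s) s := by
    intro i hi s hs
    have hI := huI i hi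
    have hs0 : 0 < s := hI.1.trans_lt hs.1
    have h1 := itd_hasDeriv isOpen_Ioo.uniqueDiffOn (Nat.lt_succ_self q) (hGp i hi).1
      (Ioo_mem_nhds hs.1 hs.2)
    rw [(hGp i hi).2 s hs] at h1
    have h1' : HasDerivAt (iteratedDerivWithin q G (Icc 0 a)) (ε * (-1)^i * g s) s := by
      refine h1.congr_of_eventuallyEq ?_
      filter_upwards [Ioo_mem_nhds hs.1 hs.2] with x hx
      exact itd_eq (Icc_mem_nhds (hI.1.trans_lt hx.1) (hx.2.trans_le hI.2)) (Ioo_mem_nhds hx.1 hx.2) q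
    have h2 := (Pfun_deriv hg_c 0 s hs0).const_mul (δ * (-1)^q)
    have h3 := (h1'.sub h2).const_mul (-ε)
    have e1 : q + 1 - q = 1 := by omega
    simp only [hD, e1]
    refine h3.congr_deriv ?_
    symm
    have : Pfun g 0 s = g s := by simp [Pfun, gk]
    rw [this, hδ]
    have hq : (-1:ℝ)^(q+1) * (-1)^q = -1 := by
      rw [← pow_add]; exact Odd.neg_one_pow ⟨q, by omega⟩
    linear_combination ((-1)^i * g s + (-1)^(q+1) * (-1)^q * g s) * hε2 + g s * hq
  have hEc : ContinuousOn (fun s => -ε * D q s) (Icc 0 a) := continuousOn_const.mul (hDc q le_rfl)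
  have hmono : ∀ i ≤ m + 1, MonotoneOn (fun s => -ε * D q s) (Icc 0 (u i)) := by
    intro i
    induction i with
    | zero => intro _; rw [hu0]; simp
    | succ i ih =>
      intro hi
      have hI := huI i (by omega)
      have h1 := ih (by omega)
      have hlt := hu i (by omega)
      have h2 : MonotoneOn (fun s => -ε * D q s) (Icc (u i) (u (i+1))) := by
        apply monotoneOn_of_deriv_nonneg (convex_Icc _ _)
        · exact hEc.mono (Icc_subset_Icc hI.1 hI.2)
        · rw [interior_Icc]; intro x hx
          exact (hlast i (by omega) x hx).differentiableAt.differentiableWithinAt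
        · rw [interior_Icc]; intro x hx
          rw [(hlast i (by omega) x hx).deriv]
          have := hg_pos x (hI.1.trans hx.1.le)
          rcases neg_one_pow_eq_or ℝ i with h | h <;> rw [h] <;> nlinarith
      have := h1.union_right h2 (isGreatest_Icc hI.1) (isLeast_Icc hlt.le)
      rwa [Icc_union_Icc_eq_Icc hI.1 hlt.le] at this
  have hM := hmono (m+1) le_rfl
  rw [hua] at hM
  have hc01 := hM (hcI 0 (by omega)) (hcI 1 (by omega)) (hcm 0 (by omega)).le
  have p0 := hcs 0 (by omega)
  have p1 := hcs 1 (by omega)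
  simp only [pow_zero, pow_one, mul_one] at p0 p1 hc01
  rcases Nat.eq_zero_or_pos n with hn | hn
  · have hm0 : m = 0 := by omega
    subst hm0
    have hA : AntitoneOn (fun s => -ε * D q s) (Icc 0 a) := by
      simp only [zero_add] at hua
      apply antitoneOn_of_deriv_nonpos (convex_Icc _ _) hEc
      · rw [interior_Icc]; intro x hx
        exact (hlast 0 le_rfl x (by simpa [hu0, hua] using hx)).differentiableAt.differentiableWithinAt
      · rw [interior_Icc]; intro x hx
        rw [(hlast 0 le_rfl x (by simpa [hu0, hua] using hx)).deriv]
        simp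
    have hc10 := hA (hcI 0 (by omega)) (hcI 1 (by omega)) (hcm 0 (by omega)).le
    simp only at hc10
    have : D q (c 0) = D q (c 1) := by
      rcases hε with rfl | rfl <;> linarith
    rw [this] at p0
    linarith
  · have hc12 := hM (hcI 1 (by omega)) (hcI 2 (by omega)) (hcm 1 (by omega)).le
    have p2 := hcs 2 (by omega)
    simp only [neg_one_sq, mul_one] at p2 hc12
    rcases hε with rfl | rfl
    · rcases lt_trichotomy τ 0 with h | h | h
      · nlinarith
      · simp [h] at p0
      · nlinarith
    · rcases lt_trichotomy τ 0 with h | h | h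
      · nlinarith
      · simp [h] at p0
      · nlinarith

open scoped ENNReal

/-- iterated tail integrals -/
noncomputable def Jt (w : ℝ → ℝ≥0∞) : ℕ → ℝ → ℝ≥0∞
  | 0 => w
  | k + 1 => fun t => ∫⁻ s in Ioi t, Jt w k s

lemma Jt_anti {w : ℝ → ℝ≥0∞} (hw : Antitone w) (k : ℕ) : Antitone (Jt w k) := by
  cases k with
  | zero => exact hw
  | succ k =>
    intro s t hst
    exact lintegral_mono_set (Ioi_subset_Ioi hst)

lemma Jt_mono {w v : ℝ → ℝ≥0∞} (h : w ≤ v) (k : ℕ) : Jt w k ≤ Jt v k := by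
  induction k with
  | zero => exact h
  | succ k ih => intro t; exact lintegral_mono ih

lemma Jt_iSup {v : ℕ → ℝ → ℝ≥0∞} (hv : ∀ N, Antitone (v N)) (hm : Monotone v) (k : ℕ) (t : ℝ) :
    Jt (fun s => ⨆ N, v N s) k t = ⨆ N, Jt (v N) k t := by
  induction k generalizing t with
  | zero => rfl
  | succ k ih =>
    simp only [Jt, ih]
    exact lintegral_iSup (fun N => (Jt_anti (hv N) k).measurable) (fun i j hij => Jt_mono (hm hij) k)

/-- truncated weight -/
noncomputable def wtr (g : ℝ → ℝ) (b : ℝ) : ℝ → ℝ≥0∞ :=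
  (Iic b).indicator (fun s => ENNReal.ofReal (g (max s 0)))

lemma gext_anti {g : ℝ → ℝ} (hg : AntitoneOn g (Ici 0)) :
    Antitone (fun s => ENNReal.ofReal (g (max s 0))) := by
  intro s t hst
  apply ENNReal.ofReal_le_ofReal
  exact hg (le_max_right s 0) (le_max_right t 0) (max_le_max_right 0 hst)

lemma wtr_anti {g : ℝ → ℝ} (hg : AntitoneOn g (Ici 0)) (b : ℝ) : Antitone (wtr g b) := by
  intro s t hst
  unfold wtr
  by_cases ht : t ∈ Iic b
  · rw [indicator_of_mem ht, indicator_of_mem (show s ∈ Iic b from hst.trans ht)]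
    exact gext_anti hg hst
  · rw [indicator_of_notMem ht]; exact zero_le

lemma wtr_mono (g : ℝ → ℝ) : Monotone (wtr g) := by
  intro a b hab
  apply indicator_le_indicator_of_subset (Iic_subset_Iic.2 hab)
  intro _; exact zero_le

lemma wtr_iSup (g : ℝ → ℝ) : (fun s => ENNReal.ofReal (g (max s 0))) =
    fun s => ⨆ N : ℕ, wtr g N s := by
  funext s
  apply le_antisymm
  · obtain ⟨N, hN⟩ := exists_nat_ge s
    refine le_trans ?_ (le_iSup _ N)
    unfold wtr
    rw [indicator_of_mem (show s ∈ Iic (N:ℝ) from hN)]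
  · apply iSup_le
    intro N
    exact indicator_le_self _ _ s

lemma Jt_wtr_zero (g : ℝ → ℝ) (b : ℝ) (k : ℕ) (s : ℝ) (hs : b < s) : Jt (wtr g b) k s = 0 := by
  induction k generalizing s with
  | zero => simp [Jt, wtr, hs]
  | succ k ih =>
    simp only [Jt]
    rw [setLIntegral_congr_fun (g := fun _ => 0) measurableSet_Ioi (fun x hx => ih x (hs.trans hx))]
    simp

/-- forward differences -/
noncomputable def dlt (h : ℝ) : ℕ → (ℝ → ℝ) → ℝ → ℝ
  | 0, F, t => F t
  | k + 1, F, t => dlt h k F (t + h) - dlt h k F t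

lemma dlt_bound {h : ℝ} (hh : 0 ≤ h) (k : ℕ) (F : ℝ → ℝ) (M : ℝ) (t : ℝ)
    (hF : ∀ s ∈ Icc t (t + k * h), |F s| ≤ M) : |dlt h k F t| ≤ 2^k * M := by
  induction k generalizing t with
  | zero => simpa [dlt] using hF t (by simp)
  | succ k ih =>
    push_cast at hF
    have h1 := ih t (fun s hs => hF s ⟨hs.1, hs.2.trans (by linarith)⟩)
    have h2 := ih (t+h) (fun s hs => hF s ⟨by linarith [hs.1], hs.2.trans (by linarith)⟩)
    have := abs_sub (dlt h k F (t+h)) (dlt h k F t)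
    simp only [dlt]
    rw [pow_succ]
    linarith

lemma dlt_cont {h T L : ℝ} (hh : 0 ≤ h) (F : ℝ → ℝ) (hF : ContinuousOn F (Ioo T L)) (k : ℕ) :
    ContinuousOn (dlt h k F) (Ioo T (L - k * h)) := by
  induction k with
  | zero => simpa [dlt] using hF
  | succ k ih =>
    simp only [dlt]
    push_cast
    refine ContinuousOn.sub ?_ (ih.mono (Ioo_subset_Ioo_right (by linarith)))
    refine ih.comp (by fun_prop) ?_
    intro s hs
    exact ⟨by linarith [hs.1], by linarith [hs.2]⟩

lemma dlt_deriv {h T L : ℝ} (hh : 0 ≤ h) (F F' : ℝ → ℝ)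
    (hF : ∀ s ∈ Ioo T L, HasDerivAt F (F' s) s) (k : ℕ) :
    ∀ s ∈ Ioo T (L - k * h), HasDerivAt (dlt h k F) (dlt h k F' s) s := by
  induction k with
  | zero => simpa [dlt] using hF
  | succ k ih =>
    push_cast
    intro s hs
    have h1 := ih s ⟨hs.1, by linarith [hs.2]⟩
    have h2 := ih (s+h) ⟨by linarith [hs.1], by linarith [hs.2]⟩
    exact (h2.comp_add_const s h).sub h1

lemma dlt_lower {g : ℝ → ℝ} (hg_pos : ∀ t ∈ Ici (0:ℝ), 0 < g t) {h T L : ℝ} (hT : 0 ≤ T)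
    (hh : 0 ≤ h) (b : ℝ) (k : ℕ) (D : ℕ → ℝ → ℝ)
    (hc : ∀ j ≤ k, ContinuousOn (D j) (Ioo T L))
    (hd : ∀ j < k, ∀ s ∈ Ioo T L, HasDerivAt (D j) (D (j+1) s) s)
    (hD : ∀ s ∈ Ioo T L, D k s = g s) (t : ℝ) (ht : t ∈ Ioo T (L - k * h)) (hb : b ≤ t + h) :
    0 ≤ dlt h k (D 0) t ∧ Jt (wtr g b) k t ≤ ENNReal.ofReal (dlt h k (D 0) t) := by
  induction k generalizing D t with
  | zero =>
    simp only [Nat.cast_zero, zero_mul, sub_zero] at ht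
    have ht0 : 0 ≤ t := hT.trans ht.1.le
    simp only [dlt, hD t ht, Jt]
    refine ⟨(hg_pos t ht0).le, ?_⟩
    have := indicator_le_self (Iic b) (fun s => ENNReal.ofReal (g (max s 0))) t
    simpa [wtr, max_eq_left ht0] using this
  | succ k ih =>
    push_cast at ht
    have ih' := ih (fun j => D (j+1)) (fun j hj => hc (j+1) (by omega))
      (fun j hj => hd (j+1) (by omega)) hD
    simp only [zero_add] at ih'
    have hsub : Icc t (t+h) ⊆ Ioo T (L - k * h) := fun s hs =>
      ⟨ht.1.trans_le hs.1, by linarith [hs.2, ht.2]⟩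
    have hcont : ContinuousOn (dlt h k (D 1)) (Icc t (t+h)) :=
      (dlt_cont hh (D 1) (hc 1 (by omega)) k).mono hsub
    have hint : IntervalIntegrable (dlt h k (D 1)) volume t (t+h) := by
      apply ContinuousOn.intervalIntegrable
      rwa [uIcc_of_le (by linarith)]
    have hftc : dlt h (k+1) (D 0) t = ∫ s in t..(t+h), dlt h k (D 1) s := by
      rw [intervalIntegral.integral_eq_sub_of_hasDerivAt (f := dlt h k (D 0)) _ hint]
      · rfl
      · intro s hs
        rw [uIcc_of_le (by linarith)] at hs
        exact dlt_deriv hh (D 0) (D 1) (hd 0 (by omega)) k s (hsub hs)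
    have hnn : ∀ s ∈ Ioc t (t+h), 0 ≤ dlt h k (D 1) s ∧
        Jt (wtr g b) k s ≤ ENNReal.ofReal (dlt h k (D 1) s) := fun s hs =>
      ih' s (hsub (Ioc_subset_Icc_self hs)) (by linarith [hs.1])
    rw [hftc, intervalIntegral.integral_of_le (by linarith)]
    constructor
    · exact setIntegral_nonneg measurableSet_Ioc (fun s hs => (hnn s hs).1)
    · rw [ofReal_integral_eq_lintegral_ofReal
        ((intervalIntegrable_iff_integrableOn_Ioc_of_le (by linarith)).1 hint)
        ((ae_restrict_iff' measurableSet_Ioc).2 (ae_of_all _ fun s hs => (hnn s hs).1))]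
      simp only [Jt]
      rw [← Ioc_union_Ioi_eq_Ioi (show t ≤ t + h by linarith),
        lintegral_union measurableSet_Ioi (by
          rw [Set.disjoint_left]; intro x hx hx'; exact absurd hx.2 (not_le.2 hx'))]
      rw [setLIntegral_congr_fun (s := Ioi (t+h)) (g := fun _ => 0) measurableSet_Ioi
        (fun x hx => Jt_wtr_zero g b k x (hb.trans_lt hx))]
      simp only [lintegral_zero, add_zero]
      exact setLIntegral_mono' measurableSet_Ioc (fun s hs => (hnn s hs).2)

/-- knot free region -/
lemma knot_free (n : ℕ) (Q : ℕ → (ℕ → ℝ) → ℝ → Prop)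
    (hQ : ∀ a, 0 < a → ∃ m u, m ≤ n ∧ u 0 = 0 ∧ u (m+1) = a ∧ Q m u a) :
    ∃ T : ℝ, 0 ≤ T ∧ ∀ L, ∃ m u a i, 0 < a ∧ Q m u a ∧ i ≤ m ∧ u i ≤ T ∧ L ≤ u (i+1) := by
  by_contra! hcon
  choose! L hL using hcon
  let x : ℕ → ℝ := fun k => Nat.rec 0 (fun _ y => max (L y) (y+1)) k
  have hx0 : x 0 = 0 := rfl
  have hxs : ∀ k, x (k+1) = max (L (x k)) (x k + 1) := fun k => rfl
  clear_value x
  have hxm : StrictMono x := strictMono_nat_of_lt_succ (fun k => by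
    rw [hxs]; exact (lt_add_one _).trans_le (le_max_right _ _))
  have hxn : ∀ k, 0 ≤ x k := fun k => hx0 ▸ hxm.monotone (Nat.zero_le k)
  have ha : 0 < x (n+1) := hx0 ▸ hxm (Nat.succ_pos n)
  obtain ⟨m, u, hm, hu0, hua, hq⟩ := hQ _ ha
  have key : ∀ k ≤ m, u (k+1) < x (k+1) := by
    intro k
    induction k with
    | zero =>
      intro hk
      exact (hL (x 0) (hxn 0) m u _ 0 ha hq hk (by rw [hu0, hx0])).trans_le (hxs 0 ▸ le_max_left _ _)
    | succ k ih =>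
      intro hk
      exact (hL (x (k+1)) (hxn (k+1)) m u _ (k+1) ha hq hk (ih (by omega)).le).trans_le (hxs (k+1) ▸ le_max_left _ _)
  have := key m le_rfl
  rw [hua] at this
  have h2 : x (m+1) ≤ x (n+1) := hxm.monotone (show m + 1 ≤ n + 1 by omega)
  linarith

/-- tail bound -/
lemma tail_bound (f g : ℝ → ℝ)
    (hf_c : ContinuousOn f (Ici 0)) (hf_pos : ∀ t ∈ Ici (0:ℝ), 0 < f t)
    (hf_anti : AntitoneOn f (Ici 0))
    (hg_c : ContinuousOn g (Ici 0)) (hg_pos : ∀ t ∈ Ici (0:ℝ), 0 < g t)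
    (hg_anti : AntitoneOn g (Ici 0))
    (r : ℕ) (n : ℕ) (C : ℝ)
    (hφ : ∀ a, 0 < a → ∃ G : ℝ → ℝ,
      IsExtremalSpline f g r n a G ∧ wNorm G f (Icc 0 a) ≤ C) :
    ∃ T : ℝ, 0 ≤ T ∧ ∀ t, T < t →
      Jt (fun s => ENNReal.ofReal (g (max s 0))) r t ≤ ENNReal.ofReal (2^r * (C * f t)) := by
  obtain ⟨T, hT, hL⟩ := knot_free n (fun m u a => ∃ G ε, PerfectSplineWith g r a m u ε G ∧
    wNorm G f (Icc 0 a) ≤ C) (by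
      intro a ha
      obtain ⟨G, ⟨⟨m, hm, u, ε, hG⟩, -⟩, hC⟩ := hφ a ha
      exact ⟨m, u, hm, hG.2.1, hG.2.2.1, G, ε, hG, hC⟩)
  refine ⟨T, hT, fun t ht => ?_⟩
  rw [wtr_iSup, Jt_iSup (fun N => wtr_anti hg_anti N) (fun i j hij => wtr_mono g (by exact_mod_cast hij))]
  apply iSup_le
  intro N
  set h : ℝ := max (N - t) 0 with hh
  have hh0 : 0 ≤ h := le_max_right _ _
  have hNh : (N:ℝ) ≤ t + h := by linarith [le_max_left ((N:ℝ) - t) 0]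
  obtain ⟨m, u, a, i, ha, ⟨G, ε, ⟨hε, hu0, hua, hu, hGc, hGp⟩, hGC⟩, hi, hui, huL⟩ := hL (t + r * h + 1)
  have hua' : u (i+1) ≤ a := by
    have B : ∀ d, ∀ i, i + d = m → u (i+1) ≤ a := by
      intro d
      induction d with
      | zero => intro i h; rw [← hua, ← h]
      | succ d ih => intro i h; exact (hu (i+1) (by omega)).le.trans (ih (i+1) (by omega))
    exact B (m - i) i (by omega)
  obtain ⟨hp1, hp2⟩ := hGp i hi
  set U := Ioo (u i) (u (i+1)) with hU
  set e : ℝ := ε * (-1)^i with he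
  have he2 : e * e = 1 := by
    rcases hε with h | h <;> rcases neg_one_pow_eq_or ℝ i with h' | h' <;> rw [he, h, h'] <;> norm_num
  have hea : |e| = 1 := by
    rcases hε with h | h <;> simp [he, h]
  have hsub : Ioo T (t + r * h + 1) ⊆ U := Ioo_subset_Ioo hui huL
  have hUd : UniqueDiffOn ℝ U := isOpen_Ioo.uniqueDiffOn
  have low := dlt_lower (L := t + r * h + 1) hg_pos hT hh0 N r
    (fun j s => e * iteratedDerivWithin j G U s)
    (fun j hj => continuousOn_const.mul
      ((hp1.continuousOn_iteratedDerivWithin (by exact_mod_cast hj) hUd).mono hsub))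
    (fun j hj s hs => (itd_hasDeriv hUd hj hp1 (isOpen_Ioo.mem_nhds (hsub hs))).const_mul e)
    (fun s hs => by
      rw [hp2 s (hsub hs), ← mul_assoc, he2, one_mul]) t ⟨ht, by linarith⟩ hNh
  refine low.2.trans (ENNReal.ofReal_le_ofReal ((le_abs_self _).trans ?_))
  apply dlt_bound hh0
  intro s hs
  have ht0 : 0 ≤ t := hT.trans ht.le
  have hs0 : 0 ≤ s := ht0.trans hs.1
  have h1 := wn_le (a := a) hf_c hf_pos hGc.continuousOn (t := s) ⟨hs0, by linarith [hs.2]⟩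
  simp only [iteratedDerivWithin_zero]
  rw [abs_mul, hea, one_mul]
  have hfs := hf_pos s hs0
  have hft := hf_anti ht0 hs0 hs.1
  have hC0 : 0 ≤ C := by
    have : 0 ≤ wNorm G f (Icc 0 a) := by
      by_contra! hneg
      have := abs_nonneg (G s)
      nlinarith
    linarith
  calc |G s| ≤ _ := h1
    _ ≤ C * f s := by gcongr
    _ ≤ C * f t := by gcongr

lemma Jt_fin_tail {w : ℝ → ℝ≥0∞} (hw : Antitone w) (r : ℕ) (T : ℝ)
    (h : ∀ t, T < t → Jt w r t < ∞) (k : ℕ) (hk : k ≤ r) : ∀ t, T < t → Jt w k t < ∞ := by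
  induction r with
  | zero => obtain rfl : k = 0 := by omega
            exact h
  | succ r ih =>
    rcases Nat.lt_or_ge r k with hk' | hk'
    · obtain rfl : k = r + 1 := by omega
      exact h
    · refine ih (fun t ht => ?_) hk'
      by_contra! htop
      have htop : Jt w r t = ∞ := top_le_iff.1 htop
      have h1 := h ((T+t)/2) (by linarith)
      have : (∫⁻ s in Ioo ((T+t)/2) t, Jt w r s) ≤ Jt w (r+1) ((T+t)/2) :=
        lintegral_mono_set Ioo_subset_Ioi_self
      have h2 : (∫⁻ s in Ioo ((T+t)/2) t, Jt w r s) = ∞ := by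
        rw [setLIntegral_congr_fun (g := fun _ => ∞) measurableSet_Ioo (fun x hx =>
          top_le_iff.1 (htop ▸ Jt_anti hw r hx.2.le))]
        rw [setLIntegral_const, ENNReal.top_mul]
        simp; linarith
      rw [h2] at this
      exact absurd h1 (not_lt.2 this)

lemma Jt_fin {w : ℝ → ℝ≥0∞} (hw : Antitone w) (hw0 : ∀ t, w t < ∞) (r : ℕ) (T : ℝ)
    (h : ∀ t, T < t → Jt w r t < ∞) (k : ℕ) (hk : k ≤ r) : ∀ t, Jt w k t < ∞ := by
  induction k with
  | zero => exact hw0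
  | succ k ih =>
    intro t
    have hI := ih (by omega)
    have hle : t ≤ max t (T+1) := le_max_left _ _
    have h1 := Jt_fin_tail hw r T h (k+1) hk (max t (T+1)) (lt_max_of_lt_right (by linarith))
    simp only [Jt] at h1 ⊢
    rw [← Ioc_union_Ioi_eq_Ioi hle]
    refine (lintegral_union_le _ _ _).trans_lt (ENNReal.add_lt_top.2 ⟨?_, h1⟩)
    calc (∫⁻ s in Ioc t (max t (T+1)), Jt w k s) ≤ ∫⁻ s in Ioc t (max t (T+1)), Jt w k t :=
          setLIntegral_mono' measurableSet_Ioc (fun s hs => Jt_anti hw k hs.1.le)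
      _ < ∞ := by
          rw [setLIntegral_const]
          exact ENNReal.mul_lt_top (hI t) (by simp)

lemma P_eq_J {g : ℝ → ℝ} (hg_c : ContinuousOn g (Ici 0)) (hg_pos : ∀ t ∈ Ici (0:ℝ), 0 < g t)
    (hg_anti : AntitoneOn g (Ici 0)) (r : ℕ)
    (hfin : ∀ k ≤ r, ∀ t, Jt (fun s => ENNReal.ofReal (g (max s 0))) k t < ∞) (k : ℕ) (hk : k ≤ r) :
    (∀ t, 0 ≤ t → Pfun g k t = (Jt (fun s => ENNReal.ofReal (g (max s 0))) k t).toReal) ∧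
    (k < r → IntegrableOn (Pfun g k) (Ioi 0)) := by
  set w : ℝ → ℝ≥0∞ := (fun s => ENNReal.ofReal (g (max s 0))) with hw
  have hwa : Antitone w := gext_anti hg_anti
  have main : ∀ k, (∀ t, 0 ≤ t → Pfun g k t = (Jt w k t).toReal) →
      (k < r → IntegrableOn (Pfun g k) (Ioi 0)) := by
    intro k hP hk
    have h1 : IntegrableOn (fun t => (Jt w k t).toReal) (Ioi 0) :=
      integrable_toReal_of_lintegral_ne_top (Jt_anti hwa k).measurable.aemeasurable
        (hfin (k+1) hk 0).ne
    exact h1.congr_fun (fun t ht => (hP t (le_of_lt ht)).symm) measurableSet_Ioi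
  have hP : ∀ t, 0 ≤ t → Pfun g k t = (Jt w k t).toReal := by
    induction k with
    | zero =>
      intro t ht
      simp [Pfun, gk, Jt, hw, max_eq_left ht, (hg_pos t ht).le]
    | succ k ih =>
      have ih' := ih (by omega)
      have hint := main k ih' (by omega)
      intro t ht
      rw [Pfun_succ hg_c k t ht, Acoef_eq]
      have e1 : (Jt w (k+1) t).toReal = ∫ s in Ioi t, Pfun g k s := by
        rw [setIntegral_congr_fun (g := fun s => (Jt w k s).toReal) measurableSet_Ioi
          (fun s hs => ih' s (ht.trans (le_of_lt hs)))]
        rw [integral_toReal (Jt_anti hwa k).measurable.aemeasurable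
          (ae_of_all _ (fun s => hfin k (by omega) s))]
        rfl
      rw [e1, ← Ioc_union_Ioi_eq_Ioi ht, setIntegral_union
        (by rw [Set.disjoint_left]; intro x hx hx'; exact absurd hx.2 (not_le.2 hx'))
        measurableSet_Ioi (hint.mono_set Ioc_subset_Ioi_self)
        (hint.mono_set (Ioi_subset_Ioi ht)), intervalIntegral.integral_of_le ht]
      ring
  exact ⟨hP, main k hP⟩

/-- Theorem 3: φ_{r,n,f}(∞) < ∞ if and only if conditions (6) and (7) hold. -/
theorem statement6
    (f g : ℝ → ℝ)
    (hf_c : ContinuousOn f (Ici 0)) (hf_pos : ∀ t ∈ Ici (0:ℝ), 0 < f t)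
    (hf_anti : AntitoneOn f (Ici 0))
    (hg_c : ContinuousOn g (Ici 0)) (hg_pos : ∀ t ∈ Ici (0:ℝ), 0 < g t)
    (hg_anti : AntitoneOn g (Ici 0))
    (r : ℕ) (hr : 1 ≤ r) (n : ℕ) (φ : ℝ → ℝ)
    (hφ : ∀ a, 0 < a → ∃ G : ℝ → ℝ,
      IsExtremalSpline f g r n a G ∧ φ a = wNorm G f (Icc 0 a)) :
    (∃ C, ∀ a, 0 < a → φ a ≤ C) ↔
      (Cond6 g r ∧ ∃ C, ∀ t ∈ Ici (0:ℝ), |Pfun g r t| ≤ C * f t) := by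
  constructor
  · rintro ⟨C, hC⟩
    obtain ⟨T, hT, hb⟩ := tail_bound f g hf_c hf_pos hf_anti hg_c hg_pos hg_anti r n C (by
      intro a ha
      obtain ⟨G, hG, e⟩ := hφ a ha
      exact ⟨G, hG, e ▸ hC a ha⟩)
    have hwa := gext_anti hg_anti
    have hfin := Jt_fin hwa (fun t => ENNReal.ofReal_lt_top) r T
      (fun t ht => (hb t ht).trans_lt ENNReal.ofReal_lt_top)
    have hP := P_eq_J hg_c hg_pos hg_anti r hfin
    refine ⟨⟨?_, fun k h1 h2 => (hP k (by omega)).2 (by omega)⟩, ?_⟩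
    · have := (hP 0 (by omega)).2 (by omega)
      have e : Pfun g 0 = g := by funext t; simp [Pfun, gk]
      rwa [e] at this
    · set J := Jt (fun s => ENNReal.ofReal (g (max s 0))) r with hJ
      have hfT := hf_pos (T+1) (show (0:ℝ) ≤ T + 1 by linarith)
      refine ⟨max (2^r * C) ((J 0).toReal / f (T+1)), fun t ht => ?_⟩
      have ht0 : 0 ≤ t := ht
      rw [(hP r le_rfl).1 t ht, abs_of_nonneg ENNReal.toReal_nonneg]
      have hft := hf_pos t ht
      rcases le_or_gt t T with h | h
      · calc (J t).toReal ≤ (J 0).toReal :=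
              ENNReal.toReal_mono (hfin r le_rfl 0).ne (Jt_anti hwa r ht0)
          _ = (J 0).toReal / f (T+1) * f (T+1) := by field_simp
          _ ≤ (J 0).toReal / f (T+1) * f t := by
              have := hf_anti ht (show (0:ℝ) ≤ T + 1 by linarith) (by linarith)
              gcongr
          _ ≤ _ := by gcongr; exact le_max_right _ _
      · have hC0 : 0 ≤ C := by
          obtain ⟨G, hG, e⟩ := hφ 1 one_pos
          have h1 := hC 1 one_pos
          obtain ⟨⟨m, hm, u, ε, hG1⟩, -⟩ := hG
          have h2 := wn_le (a := 1) hf_c hf_pos hG1.2.2.2.2.1.continuousOn (t := 0) (by simp)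
          have h3 := hf_pos 0 (by simp)
          have h4 := abs_nonneg (G 0)
          rw [e] at h1
          by_contra! hneg
          nlinarith
        calc (J t).toReal ≤ 2^r * (C * f t) :=
              ENNReal.toReal_le_of_le_ofReal (by positivity) (hb t h)
          _ = (2^r * C) * f t := by ring
          _ ≤ _ := by gcongr; exact le_max_left _ _
  · rintro ⟨-, C, hC⟩
    refine ⟨C, fun a ha => ?_⟩
    obtain ⟨G, hG, e⟩ := hφ a ha
    rw [e]
    exact upper f g hf_pos hg_c hg_pos r hr n a ha G hG C hC
end
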